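/- Let 𝒳 be a complete separable metric space and let F be a countable family of Borel measurable functions f : 𝒳 → [0,1]. If for every γ > 0 there is k ∈ ℕ such that no finite subset of 𝒳 of cardinality k is γ-shattered by F (i.e., dim_γ(F) < ∞ for all γ > 0), then for every stationary ergodic process X₁, X₂, … with values in 𝒳 the discrepancies converge to zero: almost surely Γ_m(F) → 0 as m → ∞. -/

import Mathlib

open MeasureTheory Filter

/-- The `m`-sample discrepancy of the family `F` at the sample point `ω`, for the
process `Xᵢ = ξ ∘ Tⁱ`. -/
noncomputable def discrepancy {Ω X : Type*} [MeasurableSpace Ω] (μ : Measure Ω)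
    (T : Ω → Ω) (ξ : Ω → X) (F : Set (X → ℝ)) (m : ℕ) (ω : Ω) : ℝ :=
  ⨆ f : F, |(1 / (m : ℝ)) * ∑ i ∈ Finset.Icc 1 m, (f : X → ℝ) (ξ (T^[i] ω)) -
      ∫ x, (f : X → ℝ) (ξ x) ∂μ|

/-- `F` γ-shatters the finite set `D`. -/
def GammaShatters {X : Type*} (F : Set (X → ℝ)) (γ : ℝ) (D : Finset X) : Prop :=
  ∃ α : ℝ, ∀ D₀ ⊆ D, ∃ f ∈ F,
    (∀ x ∈ D₀, f x > α + γ) ∧ (∀ x ∈ D, x ∉ D₀ → f x < α - γ)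

/-- The running maximum of `0` and the first `n` Birkhoff sums of `ψ`. -/
noncomputable def birkhoffMax {Ω : Type*} (T : Ω → Ω) (ψ : Ω → ℝ) : ℕ → Ω → ℝ
  | 0 => fun _ => 0
  | n + 1 => fun ω => max 0 (ψ ω + birkhoffMax T ψ n (T ω))

section Birkhoff

variable {Ω : Type*} {T : Ω → Ω} {ψ : Ω → ℝ}

lemma birkhoffMax_nonneg (n : ℕ) (ω : Ω) : 0 ≤ birkhoffMax T ψ n ω := by
  cases n with
  | zero => exact le_rfl
  | succ n => exact le_max_left _ _

lemma birkhoffMax_le_succ (n : ℕ) (ω : Ω) :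
    birkhoffMax T ψ n ω ≤ birkhoffMax T ψ (n + 1) ω := by
  induction n generalizing ω with
  | zero => exact birkhoffMax_nonneg _ _
  | succ n ih => exact max_le_max le_rfl (add_le_add le_rfl (ih (T ω)))

lemma birkhoffSum_le_birkhoffMax (n : ℕ) (ω : Ω) :
    birkhoffSum T ψ n ω ≤ birkhoffMax T ψ n ω := by
  induction n generalizing ω with
  | zero => simp [birkhoffMax]
  | succ n ih =>
    rw [birkhoffSum_succ']
    exact (add_le_add le_rfl (ih (T ω))).trans (le_max_right _ _)

lemma birkhoffMax_succ_sub (n : ℕ) (ω : Ω) :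
    birkhoffMax T ψ (n + 1) ω - birkhoffMax T ψ n (T ω) =
      max (-birkhoffMax T ψ n (T ω)) (ψ ω) := by
  simp only [birkhoffMax]
  rw [max_sub_sub_right _ _ _ |>.symm]
  simp

lemma bddAbove_birkhoffMax_comp_iff (ω : Ω) :
    BddAbove (Set.range fun n => birkhoffMax T ψ n (T ω)) ↔
      BddAbove (Set.range fun n => birkhoffMax T ψ n ω) := by
  simp only [bddAbove_def, Set.forall_mem_range]
  constructor
  · rintro ⟨C, hC⟩
    refine ⟨max 0 (ψ ω + C), fun n => (birkhoffMax_le_succ n ω).trans ?_⟩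
    exact max_le_max le_rfl (add_le_add le_rfl (hC n))
  · rintro ⟨C, hC⟩
    refine ⟨C - ψ ω, fun n => ?_⟩
    have := (le_max_right _ _).trans (hC (n + 1))
    linarith

variable [MeasurableSpace Ω] {μ : Measure Ω}

lemma measurable_birkhoffMax (hT : Measurable T) (hψ : Measurable ψ) (n : ℕ) :
    Measurable (birkhoffMax T ψ n) := by
  induction n with
  | zero => exact measurable_const
  | succ n ih => exact measurable_const.max (hψ.add (ih.comp hT))

lemma integrable_birkhoffMax [IsProbabilityMeasure μ] (hT : MeasurePreserving T μ μ)
    (hψ : Integrable ψ μ) (n : ℕ) : Integrable (birkhoffMax T ψ n) μ := by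
  induction n with
  | zero => exact integrable_zero _ _ _
  | succ n ih =>
    exact (integrable_zero _ _ _).sup (hψ.add (hT.integrable_comp_of_integrable ih))

lemma bddAbove_birkhoffMax_of_integral_neg [IsProbabilityMeasure μ] (hT : Ergodic T μ)
    (hψm : Measurable ψ) (hψ : Integrable ψ μ) (hneg : ∫ ω, ψ ω ∂μ < 0) :
    ∀ᵐ ω ∂μ, BddAbove (Set.range fun n => birkhoffMax T ψ n ω) := by
  have hTm := hT.toMeasurePreserving.measurable
  set A : Set Ω := {ω | BddAbove (Set.range fun n => birkhoffMax T ψ n ω)} with hA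
  have hAm : MeasurableSet A :=
    measurableSet_bddAbove_range fun n => measurable_birkhoffMax hTm hψm n
  have hAinv : T ⁻¹' A = A := Set.ext fun ω => bddAbove_birkhoffMax_comp_iff ω
  rcases hT.toPreErgodic.measure_self_or_compl_eq_zero hAm hAinv with h | h
  · exfalso
    have hint := fun n => integrable_birkhoffMax hT.toMeasurePreserving hψ n
    have hcomp : ∀ n, Integrable (fun ω => birkhoffMax T ψ n (T ω)) μ := fun n =>
      hT.toMeasurePreserving.integrable_comp_of_integrable (hint n)
    have hnn : ∀ n, 0 ≤ ∫ ω, max (-birkhoffMax T ψ n (T ω)) (ψ ω) ∂μ := by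
      intro n
      have h1 : ∫ ω, birkhoffMax T ψ n (T ω) ∂μ = ∫ ω, birkhoffMax T ψ n ω ∂μ := by
        have := integral_map (μ := μ) hTm.aemeasurable
          (f := birkhoffMax T ψ n) (measurable_birkhoffMax hTm hψm n).aestronglyMeasurable
        rw [← this, hT.toMeasurePreserving.map_eq]
      simp_rw [← birkhoffMax_succ_sub]
      rw [integral_sub (hint _) (hcomp n), h1, sub_nonneg]
      exact integral_mono (hint _) (hint _) fun ω => birkhoffMax_le_succ n ω
    have hlim : Tendsto (fun n => ∫ ω, max (-birkhoffMax T ψ n (T ω)) (ψ ω) ∂μ) atTop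
        (nhds (∫ ω, ψ ω ∂μ)) := by
      refine tendsto_integral_of_dominated_convergence (fun ω => |ψ ω|) (fun n => ?_) hψ.abs
        (fun n => ae_of_all _ fun ω => ?_) ?_
      · exact ((((measurable_birkhoffMax hTm hψm n).comp hTm).neg).max
          hψm).aestronglyMeasurable
      · rw [Real.norm_eq_abs, abs_le]
        have := birkhoffMax_nonneg (T := T) (ψ := ψ) n (T ω)
        exact ⟨(neg_abs_le _).trans (le_max_right _ _),
          max_le ((neg_nonpos.2 this).trans (abs_nonneg _)) (le_abs_self _)⟩
      · filter_upwards [measure_eq_zero_iff_ae_notMem.1 h] with ω hω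
        have hω' : ¬ BddAbove (Set.range fun n => birkhoffMax T ψ n (T ω)) :=
          fun hb => hω ((bddAbove_birkhoffMax_comp_iff ω).1 hb)
        have ht := tendsto_atTop_of_monotone
          (monotone_nat_of_le_succ fun n => birkhoffMax_le_succ (T := T) (ψ := ψ) n (T ω))
        rcases ht with ht | ⟨l, hl⟩
        · refine tendsto_const_nhds.congr' ?_
          filter_upwards [ht.eventually_ge_atTop (-ψ ω)] with n hn
          rw [max_eq_right]
          linarith
        · exact absurd hl.bddAbove_range hω'
    exact absurd (ge_of_tendsto' hlim hnn) (not_le.2 hneg)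
  · exact measure_eq_zero_iff_ae_notMem.1 h |>.mono fun ω hω => not_not.1 hω

lemma eventually_birkhoffAverage_le [IsProbabilityMeasure μ] (hT : Ergodic T μ) {φ : Ω → ℝ}
    (hφm : Measurable φ) (hφ : Integrable φ μ) {ε : ℝ} (hε : 0 < ε) :
    ∀ᵐ ω ∂μ, ∀ᶠ n : ℕ in atTop, (1 / (n : ℝ)) * birkhoffSum T φ n ω ≤ ∫ ω, φ ω ∂μ + ε := by
  set c := ∫ ω, φ ω ∂μ + ε / 2 with hc
  have hneg : ∫ ω, (φ ω - c) ∂μ < 0 := by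
    rw [integral_sub hφ (integrable_const _)]
    simp [hc, hε]
  filter_upwards [bddAbove_birkhoffMax_of_integral_neg hT (hφm.sub measurable_const)
    (hφ.sub (integrable_const c)) hneg] with ω hω
  obtain ⟨C, hC⟩ : BddAbove (Set.range fun n => birkhoffMax T (fun ω => φ ω - c) n ω) := hω
  have hsum : ∀ n : ℕ, birkhoffSum T φ n ω ≤ n * c + C := by
    intro n
    have h1 := birkhoffSum_le_birkhoffMax (T := T) (ψ := fun ω => φ ω - c) n ω
    have h2 := hC ⟨n, rfl⟩
    have h3 : birkhoffSum T (fun ω => φ ω - c) n ω = birkhoffSum T φ n ω - n * c := by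
      simp [birkhoffSum, Finset.sum_sub_distrib]
    simp only at h2
    linarith
  filter_upwards [eventually_gt_atTop 0,
    (tendsto_natCast_atTop_atTop (R := ℝ)).eventually_ge_atTop (C / (ε / 2))] with n hn hn'
  have hn0 : (0 : ℝ) < n := by exact_mod_cast hn
  rw [div_le_iff₀ (by positivity)] at hn'
  rw [one_div, inv_mul_le_iff₀ hn0]
  have := hsum n
  rw [hc] at this
  linarith

/-- Birkhoff's pointwise ergodic theorem for an ergodic map. -/
lemma tendsto_average_of_ergodic [IsProbabilityMeasure μ] (hT : Ergodic T μ) {φ : Ω → ℝ}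
    (hφm : Measurable φ) (hφ : Integrable φ μ) :
    ∀ᵐ ω ∂μ, Tendsto (fun n : ℕ => (1 / (n : ℝ)) * ∑ i ∈ Finset.Icc 1 n, φ (T^[i] ω)) atTop
      (nhds (∫ ω, φ ω ∂μ)) := by
  have hu : ∀ k : ℕ, ∀ᵐ ω ∂μ, ∀ᶠ n : ℕ in atTop,
      (1 / (n : ℝ)) * birkhoffSum T φ n ω ≤ ∫ ω, φ ω ∂μ + 1 / ((k : ℝ) + 1) := fun k =>
    eventually_birkhoffAverage_le hT hφm hφ (by positivity)
  have hl : ∀ k : ℕ, ∀ᵐ ω ∂μ, ∀ᶠ n : ℕ in atTop,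
      (1 / (n : ℝ)) * birkhoffSum T (fun ω => -φ ω) n ω ≤
        ∫ ω, -φ ω ∂μ + 1 / ((k : ℝ) + 1) := fun k =>
    eventually_birkhoffAverage_le hT hφm.neg hφ.neg (by positivity)
  have key : ∀ᵐ ω ∂μ, Tendsto (fun n : ℕ => (1 / (n : ℝ)) * birkhoffSum T φ n ω) atTop
      (nhds (∫ ω, φ ω ∂μ)) := by
    filter_upwards [ae_all_iff.2 hu, ae_all_iff.2 hl] with ω h1 h2
    rw [Metric.tendsto_nhds]
    intro ε hε
    obtain ⟨k, hk⟩ := exists_nat_one_div_lt hε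
    filter_upwards [h1 k, h2 k] with n hn1 hn2
    have h3 : birkhoffSum T (fun ω => -φ ω) n ω = -birkhoffSum T φ n ω := by
      simp [birkhoffSum]
    rw [h3, integral_neg] at hn2
    rw [Real.dist_eq, abs_lt]
    constructor <;> linarith
  filter_upwards [hT.toMeasurePreserving.quasiMeasurePreserving.ae key] with ω hω
  have hshift : ∀ n : ℕ, birkhoffSum T φ n (T ω) = ∑ i ∈ Finset.Icc 1 n, φ (T^[i] ω) := by
    intro n
    rw [← Finset.Ico_add_one_right_eq_Icc, Finset.sum_Ico_eq_sum_range]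
    simp [birkhoffSum, add_comm 1, Function.iterate_succ_apply]
  simpa only [hshift] using hω

end Birkhoff

section Shattering

variable {X : Type*} [MeasurableSpace X] {ν : Measure X} {F : Set (X → ℝ)}

/-- If along an ultrafilter every non-null subset of a non-null set `H` is split by the levels
`α ± γ`, then `F` shatters sets of every cardinality. -/
lemma exists_gammaShatters_of_eventually_split (hFm : ∀ f ∈ F, Measurable f)
    (U : Ultrafilter F) {α γ : ℝ} (hγ : 0 < γ) {H : Set X} (hHm : MeasurableSet H)
    (hH : 0 < ν H)
    (hsplit : ∀ B ⊆ H, MeasurableSet B → 0 < ν B → ∀ᶠ f : F in U,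
      0 < ν (B ∩ {x | α + γ < f.1 x}) ∧ 0 < ν (B ∩ {x | f.1 x < α - γ})) (k : ℕ) :
    ∃ D : Finset X, D.card = k ∧ GammaShatters F γ D := by
  classical
  have hpat : ∀ n : ℕ, ∃ f : Fin n → F, ∀ s : Fin n → Bool,
      ∃ B ⊆ H, MeasurableSet B ∧ 0 < ν B ∧ ∀ x ∈ B, ∀ i,
        (s i = true → α + γ < (f i).1 x) ∧ (s i = false → (f i).1 x < α - γ) := by
    intro n
    induction n with
    | zero => exact ⟨Fin.elim0, fun s => ⟨H, subset_rfl, hHm, hH, fun x _ i => i.elim0⟩⟩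
    | succ n ih =>
      obtain ⟨f, hf⟩ := ih
      choose B hBH hBm hB0 hB using hf
      obtain ⟨g, hg⟩ := (eventually_all.2 fun s =>
        hsplit (B s) (hBH s) (hBm s) (hB0 s)).exists
      refine ⟨Fin.cons g f, fun s => ?_⟩
      have hgm := hFm g.1 g.2
      cases hs : s 0 with
      | true =>
        refine ⟨_, Set.inter_subset_left.trans (hBH (Fin.tail s)),
          (hBm _).inter (measurableSet_lt measurable_const hgm), (hg (Fin.tail s)).1, ?_⟩
        rintro x ⟨hxB, hx⟩ i
        refine Fin.cases ?_ (fun j => ?_) i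
        · simpa [hs] using hx
        · simpa [Fin.tail] using hB _ x hxB j
      | false =>
        refine ⟨_, Set.inter_subset_left.trans (hBH (Fin.tail s)),
          (hBm _).inter (measurableSet_lt hgm measurable_const), (hg (Fin.tail s)).2, ?_⟩
        rintro x ⟨hxB, hx⟩ i
        refine Fin.cases ?_ (fun j => ?_) i
        · simpa [hs] using hx
        · simpa [Fin.tail] using hB _ x hxB j
  let e := Fintype.equivFin (Finset (Fin k))
  obtain ⟨f, hf⟩ := hpat (Fintype.card (Finset (Fin k)))
  have hpt : ∀ j : Fin k, ∃ x, ∀ S : Finset (Fin k),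
      (j ∈ S → α + γ < (f (e S)).1 x) ∧ (j ∉ S → (f (e S)).1 x < α - γ) := by
    intro j
    obtain ⟨B, -, -, hB0, hB⟩ := hf fun i => decide (j ∈ e.symm i)
    obtain ⟨x, hx⟩ := nonempty_of_measure_ne_zero hB0.ne'
    exact ⟨x, fun S => by simpa using hB x hx (e S)⟩
  choose x hx using hpt
  have hinj : Function.Injective x := by
    intro i j hij
    by_contra hne
    have h1 := (hx i {i}).1 (by simp)
    have h2 := (hx j {i}).2 (by simpa using Ne.symm hne)
    rw [hij] at h1
    linarith
  refine ⟨Finset.univ.image x, by simp [Finset.card_image_of_injective _ hinj], α,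
    fun D₀ hD₀ => ?_⟩
  refine ⟨(f (e (Finset.univ.filter fun j => x j ∈ D₀))).1, Subtype.property _, ?_, ?_⟩
  · intro y hy
    obtain ⟨j, -, rfl⟩ := Finset.mem_image.1 (hD₀ hy)
    exact (hx j _).1 (by simpa using hy)
  · intro y hyD hy
    obtain ⟨j, -, rfl⟩ := Finset.mem_image.1 hyD
    exact (hx j _).2 (by simpa using hy)

lemma exists_subset_eventually_mem_Icc (hFm : ∀ f ∈ F, Measurable f)
    (hFb : ∀ f ∈ F, ∀ x, f x ∈ Set.Icc (0 : ℝ) 1)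
    (hdim : ∀ γ : ℝ, 0 < γ → ∃ k : ℕ, ∀ D : Finset X, D.card = k → ¬ GammaShatters F γ D)
    (U : Ultrafilter F) {H : Set X} (hHm : MeasurableSet H) (hH : 0 < ν H) (n : ℕ) :
    ∃ B ⊆ H, MeasurableSet B ∧ 0 < ν B ∧ ∃ a : ℝ, ∀ᶠ f : F in U, ∀ᵐ x ∂ν, x ∈ B →
      f.1 x ∈ Set.Icc a (a + (3 / 4 : ℝ) ^ n) := by
  induction n with
  | zero =>
    refine ⟨H, subset_rfl, hHm, hH, 0, Eventually.of_forall fun f => ae_of_all _ fun x _ => ?_⟩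
    simpa using hFb f.1 f.2 x
  | succ n ih =>
    obtain ⟨B, hBH, hBm, hB0, a, ha⟩ := ih
    set L := (3 / 4 : ℝ) ^ n with hL
    have hL0 : 0 < L := by positivity
    obtain ⟨k, hk⟩ := hdim (L / 4) (by positivity)
    have hns : ¬ ∀ C ⊆ B, MeasurableSet C → 0 < ν C → ∀ᶠ f : F in U,
        0 < ν (C ∩ {x | a + L / 2 + L / 4 < f.1 x}) ∧
          0 < ν (C ∩ {x | f.1 x < a + L / 2 - L / 4}) := by
      intro h
      obtain ⟨D, hD, hsh⟩ :=
        exists_gammaShatters_of_eventually_split hFm U (by positivity) hBm hB0 h k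
      exact hk D hD hsh
    push Not at hns
    obtain ⟨C, hCB, hCm, hC0, hC⟩ := hns
    refine ⟨C, hCB.trans hBH, hCm, hC0, ?_⟩
    have hor : ∀ᶠ f : F in U, ν (C ∩ {x | a + L / 2 + L / 4 < f.1 x}) = 0 ∨
        ν (C ∩ {x | f.1 x < a + L / 2 - L / 4}) = 0 := by
      filter_upwards [hC] with f hf
      by_cases h0 : ν (C ∩ {x | a + L / 2 + L / 4 < f.1 x}) = 0
      · exact Or.inl h0
      · exact Or.inr (nonpos_iff_eq_zero.1 (hf (pos_iff_ne_zero.2 h0)))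
    rcases Ultrafilter.eventually_or.1 hor with h | h
    · refine ⟨a, ?_⟩
      filter_upwards [h, ha] with f hf1 hf2
      filter_upwards [measure_eq_zero_iff_ae_notMem.1 hf1, hf2] with x hx1 hx2 hxC
      refine ⟨(hx2 (hCB hxC)).1, ?_⟩
      have : ¬ a + L / 2 + L / 4 < f.1 x := fun h => hx1 ⟨hxC, h⟩
      rw [pow_succ, ← hL]
      linarith
    · refine ⟨a + L / 4, ?_⟩
      filter_upwards [h, ha] with f hf1 hf2
      filter_upwards [measure_eq_zero_iff_ae_notMem.1 hf1, hf2] with x hx1 hx2 hxC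
      have h1 : ¬ f.1 x < a + L / 2 - L / 4 := fun h => hx1 ⟨hxC, h⟩
      have h2 := (hx2 (hCB hxC)).2
      rw [pow_succ, ← hL]
      constructor <;> linarith

/-- Along `U`, the functions of `F` are eventually within `δ` of a single integrable function,
almost everywhere on `A`. -/
def ApproxOn (ν : Measure X) (U : Ultrafilter F) (δ : ℝ) (A : Set X) : Prop :=
  MeasurableSet A ∧ ∃ g : X → ℝ, Measurable g ∧ Integrable g ν ∧ (∀ x ∉ A, g x = 0) ∧
    ∀ᶠ f : F in U, ∀ᵐ x ∂ν, x ∈ A → |f.1 x - g x| ≤ δ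

lemma ApproxOn.union {U : Ultrafilter F} {δ : ℝ} {A B : Set X} (hA : ApproxOn ν U δ A)
    (hB : ApproxOn ν U δ B) : ApproxOn ν U δ (A ∪ B) := by
  classical
  obtain ⟨hAm, g, hgm, hgi, hg0, hg⟩ := hA
  obtain ⟨hBm, h, hhm, hhi, hh0, hh⟩ := hB
  refine ⟨hAm.union hBm, A.piecewise g h, hgm.piecewise hAm hhm,
    Integrable.piecewise hAm hgi.integrableOn hhi.integrableOn, fun x hx => ?_, ?_⟩
  · rw [Set.mem_union, not_or] at hx
    rw [Set.piecewise_eq_of_notMem _ _ _ hx.1, hh0 x hx.2]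
  · filter_upwards [hg, hh] with f hf1 hf2
    filter_upwards [hf1, hf2] with x hx1 hx2 hx
    by_cases hxA : x ∈ A
    · simpa [hxA] using hx1 hxA
    · simpa [hxA] using hx2 (hx.resolve_left hxA)

lemma exists_approxOn_compl_lt [IsProbabilityMeasure ν] (hFm : ∀ f ∈ F, Measurable f)
    (hFb : ∀ f ∈ F, ∀ x, f x ∈ Set.Icc (0 : ℝ) 1)
    (hdim : ∀ γ : ℝ, 0 < γ → ∃ k : ℕ, ∀ D : Finset X, D.card = k → ¬ GammaShatters F γ D)
    (U : Ultrafilter F) {δ : ℝ} (hδ : 0 < δ) {η : ℝ} (hη : 0 < η) :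
    ∃ A, ApproxOn ν U δ A ∧ ν.real Aᶜ < η := by
  have hgood : ∀ H, MeasurableSet H → 0 < ν H → ∃ B ⊆ H, 0 < ν B ∧ ApproxOn ν U δ B := by
    intro H hHm hH
    obtain ⟨n, hn⟩ := exists_pow_lt_of_lt_one hδ (by norm_num : (3 / 4 : ℝ) < 1)
    obtain ⟨B, hBH, hBm, hB0, a, ha⟩ := exists_subset_eventually_mem_Icc hFm hFb hdim U hHm hH n
    refine ⟨B, hBH, hB0, hBm, B.indicator fun _ => a, measurable_const.indicator hBm,
      (integrable_const a).indicator hBm, fun x hx => Set.indicator_of_notMem hx _, ?_⟩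
    filter_upwards [ha] with f hf
    filter_upwards [hf] with x hx hxB
    rw [Set.indicator_of_mem hxB, abs_le]
    obtain ⟨h1, h2⟩ := hx hxB
    constructor <;> linarith
  have hempty : ApproxOn ν U δ ∅ :=
    ⟨MeasurableSet.empty, 0, measurable_zero, integrable_zero _ _ _, fun _ _ => rfl,
      Eventually.of_forall fun f => ae_of_all _ fun x hx => hx.elim⟩
  set S : Set ℝ := (fun A => ν.real A) '' {A | ApproxOn ν U δ A} with hS
  have hSne : S.Nonempty := ⟨_, ∅, hempty, rfl⟩
  have hSb : BddAbove S := ⟨1, by rintro _ ⟨A, -, rfl⟩; exact measureReal_le_one⟩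
  have hseq : ∀ n : ℕ, ∃ A, ApproxOn ν U δ A ∧ sSup S - 1 / ((n : ℝ) + 1) < ν.real A := by
    intro n
    obtain ⟨_, ⟨A, hA, rfl⟩, hlt⟩ := exists_lt_of_lt_csSup hSne
      (sub_lt_self (sSup S) (by positivity : 0 < 1 / ((n : ℝ) + 1)))
    exact ⟨A, hA, hlt⟩
  choose A hA hAlt using hseq
  have hnull : ν (⋃ n, A n)ᶜ = 0 := by
    by_contra hne
    obtain ⟨B, hBH, hB0, hB⟩ := hgood _ (MeasurableSet.iUnion fun n => (hA n).1).compl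
      (pos_iff_ne_zero.2 hne)
    have hBr : 0 < ν.real B := ENNReal.toReal_pos hB0.ne' (measure_ne_top _ _)
    obtain ⟨n, hn⟩ := exists_nat_one_div_lt hBr
    have hdisj : Disjoint (A n) B :=
      Set.disjoint_left.2 fun x hx hxB => hBH hxB (Set.mem_iUnion.2 ⟨n, hx⟩)
    have h1 := le_csSup hSb ⟨_, (hA n).union hB, rfl⟩
    have h2 : ν.real (A n ∪ B) = ν.real (A n) + ν.real B := measureReal_union hdisj hB.1
    simp only [h2] at h1
    have := hAlt n
    linarith
  have hsup : 1 ≤ sSup S := by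
    have hacc : ∀ n, ApproxOn ν U δ (Set.accumulate A n) := by
      intro n
      induction n with
      | zero => simpa using hA 0
      | succ n ih => rw [Set.accumulate_succ]; exact ih.union (hA _)
    have hlim := tendsto_measure_iUnion_accumulate (μ := ν) (f := A)
    have hone : ν (⋃ n, A n) = 1 :=
      (prob_compl_eq_zero_iff (MeasurableSet.iUnion fun n => (hA n).1)).1 hnull
    rw [hone] at hlim
    have hlim' := (ENNReal.tendsto_toReal ENNReal.one_ne_top).comp hlim
    exact le_of_tendsto' hlim' fun n => le_csSup hSb ⟨_, hacc n, rfl⟩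
  obtain ⟨_, ⟨B, hB, rfl⟩, hlt⟩ := exists_lt_of_lt_csSup hSne
    (sub_lt_self (sSup S) hη)
  refine ⟨B, hB, ?_⟩
  rw [probReal_compl_eq_one_sub hB.1]
  simp only at hlt
  linarith

end Shattering

section UniformConvergence

variable {X Ω : Type*} [MeasurableSpace X] [MeasurableSpace Ω] {μ : Measure Ω}
  [IsProbabilityMeasure μ] {T : Ω → Ω} {ξ : Ω → X} {F : Set (X → ℝ)}

/-- A family of functions sharing an integrable bracket `g ± h` obeys the ergodic theorem
uniformly up to an error controlled by `∫ h`. -/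
lemma eventually_discrepancy_le_of_bracket (hFc : F.Countable) (hFm : ∀ f ∈ F, Measurable f)
    (hT : Ergodic T μ) (hξ : Measurable ξ) {g h : X → ℝ} (hgm : Measurable g)
    (hg : Integrable g (μ.map ξ)) (hhm : Measurable h) (hh : Integrable h (μ.map ξ)) {ε : ℝ}
    (hε : 2 * ∫ x, h x ∂(μ.map ξ) < ε) (V : Set F)
    (hV : ∀ f ∈ V, ∀ᵐ x ∂(μ.map ξ), |f.1 x - g x| ≤ h x) :
    ∀ᵐ ω ∂μ, ∀ᶠ m : ℕ in atTop, ∀ f ∈ V,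
      |(1 / (m : ℝ)) * ∑ i ∈ Finset.Icc 1 m, f.1 (ξ (T^[i] ω)) - ∫ x, f.1 (ξ x) ∂μ| ≤ ε := by
  have := hFc.to_subtype
  have hgξ : Integrable (fun ω => g (ξ ω)) μ := hg.comp_measurable hξ
  have hhξ : Integrable (fun ω => h (ξ ω)) μ := hh.comp_measurable hξ
  have hVξ : ∀ f ∈ V, ∀ᵐ ω ∂μ, |f.1 (ξ ω) - g (ξ ω)| ≤ h (ξ ω) := fun f hf =>
    ae_of_ae_map hξ.aemeasurable (hV f hf)
  have horbit : ∀ᵐ ω ∂μ, ∀ f : F, f ∈ V → ∀ i : ℕ,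
      |f.1 (ξ (T^[i] ω)) - g (ξ (T^[i] ω))| ≤ h (ξ (T^[i] ω)) := by
    refine ae_all_iff.2 fun f => eventually_imp_distrib_left.2 fun hf => ae_all_iff.2 fun i => ?_
    exact (hT.toMeasurePreserving.iterate i).quasiMeasurePreserving.ae (hVξ f hf)
  rw [integral_map hξ.aemeasurable hhm.aestronglyMeasurable] at hε
  set c := ∫ ω, h (ξ ω) ∂μ with hc
  filter_upwards [horbit, tendsto_average_of_ergodic hT (hgm.comp hξ) hgξ,
    tendsto_average_of_ergodic hT (hhm.comp hξ) hhξ] with ω hω hlg hlh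
  have hlim := ((hlg.sub_const (∫ ω, g (ξ ω) ∂μ)).abs.add hlh).add_const c
  have hlt : |∫ ω, g (ξ ω) ∂μ - ∫ ω, g (ξ ω) ∂μ| + c + c < ε := by
    rw [sub_self, abs_zero]
    linarith
  filter_upwards [hlim.eventually_lt_const hlt] with m hm f hf
  refine le_trans ?_ hm.le
  have h1 : |(1 / (m : ℝ)) * ∑ i ∈ Finset.Icc 1 m, f.1 (ξ (T^[i] ω)) -
      (1 / (m : ℝ)) * ∑ i ∈ Finset.Icc 1 m, g (ξ (T^[i] ω))| ≤
      (1 / (m : ℝ)) * ∑ i ∈ Finset.Icc 1 m, h (ξ (T^[i] ω)) := by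
    rw [← mul_sub, ← Finset.sum_sub_distrib, abs_mul, abs_of_nonneg (by positivity)]
    gcongr
    exact (Finset.abs_sum_le_sum_abs _ _).trans (Finset.sum_le_sum fun i _ => hω f hf i)
  have hfξ : Integrable (fun ω => f.1 (ξ ω)) μ := by
    refine (hgξ.norm.add hhξ).mono' ((hFm f.1 f.2).comp hξ).aestronglyMeasurable ?_
    filter_upwards [hVξ f hf] with ω hω
    have := abs_sub_abs_le_abs_sub (f.1 (ξ ω)) (g (ξ ω))
    simp only [Pi.add_apply, Real.norm_eq_abs]
    linarith
  have h2 : |∫ ω, f.1 (ξ ω) ∂μ - ∫ ω, g (ξ ω) ∂μ| ≤ c := by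
    rw [← integral_sub hfξ hgξ]
    exact (abs_integral_le_integral_abs).trans
      (integral_mono_ae (hfξ.sub hgξ).abs hhξ (hVξ f hf))
  simp only [Function.comp_apply]
  rw [abs_le] at h1 h2 ⊢
  have h3 := neg_abs_le ((1 / (m : ℝ)) * ∑ i ∈ Finset.Icc 1 m, g (ξ (T^[i] ω)) -
    ∫ ω, g (ξ ω) ∂μ)
  have h4 := le_abs_self ((1 / (m : ℝ)) * ∑ i ∈ Finset.Icc 1 m, g (ξ (T^[i] ω)) -
    ∫ ω, g (ξ ω) ∂μ)
  constructor <;> linarith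

/-- A property of sets that passes to subsets and finite unions and holds on some member of every
ultrafilter holds on the whole space. -/
lemma of_forall_ultrafilter_exists {α : Type*} {P : Set α → Prop} (hempty : P ∅)
    (hmono : ∀ s t, s ⊆ t → P t → P s) (hunion : ∀ s t, P s → P t → P (s ∪ t))
    (hU : ∀ U : Ultrafilter α, ∃ s ∈ U, P s) : P Set.univ := by
  let l : Filter α := Filter.comk P hempty (fun t ht s hs => hmono s t hs ht)
    (fun s hs t ht => hunion s t hs ht)
  rcases l.eq_or_neBot with hl | hl
  · have : ∅ ∈ l := by rw [hl]; trivial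
    simpa [l, Filter.mem_comk] using this
  · obtain ⟨s, hs, hPs⟩ := hU (Ultrafilter.of l)
    have : sᶜ ∈ Ultrafilter.of l := Ultrafilter.of_le l (by simpa [l, Filter.mem_comk] using hPs)
    exact absurd hs (Ultrafilter.compl_mem_iff_notMem.1 this)

lemma eventually_uniform_average_le (hFc : F.Countable) (hFm : ∀ f ∈ F, Measurable f)
    (hFb : ∀ f ∈ F, ∀ x, f x ∈ Set.Icc (0 : ℝ) 1)
    (hdim : ∀ γ : ℝ, 0 < γ → ∃ k : ℕ, ∀ D : Finset X, D.card = k → ¬ GammaShatters F γ D)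
    (hT : Ergodic T μ) (hξ : Measurable ξ) {ε : ℝ} (hε : 0 < ε) :
    ∀ᵐ ω ∂μ, ∀ᶠ m : ℕ in atTop, ∀ f ∈ (Set.univ : Set F),
      |(1 / (m : ℝ)) * ∑ i ∈ Finset.Icc 1 m, f.1 (ξ (T^[i] ω)) - ∫ x, f.1 (ξ x) ∂μ| ≤ ε := by
  refine of_forall_ultrafilter_exists (P := fun V : Set F => ∀ᵐ ω ∂μ, ∀ᶠ m : ℕ in atTop,
    ∀ f ∈ V, |(1 / (m : ℝ)) * ∑ i ∈ Finset.Icc 1 m, f.1 (ξ (T^[i] ω)) -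
      ∫ x, f.1 (ξ x) ∂μ| ≤ ε) (by simp) ?_ ?_ ?_
  · intro s t hst ht
    filter_upwards [ht] with ω hω
    filter_upwards [hω] with m hm f hf using hm f (hst hf)
  · intro s t hs ht
    filter_upwards [hs, ht] with ω h1 h2
    filter_upwards [h1, h2] with m hm1 hm2 f hf using hf.elim (hm1 f) (hm2 f)
  · intro U
    have : IsProbabilityMeasure (μ.map ξ) := Measure.isProbabilityMeasure_map hξ.aemeasurable
    obtain ⟨A, ⟨hAm, g, hgm, hgi, hg0, hg⟩, hAlt⟩ := exists_approxOn_compl_lt (ν := μ.map ξ)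
      hFm hFb hdim U (by positivity : 0 < ε / 5) (by positivity : 0 < ε / 5)
    have hind : Integrable (Aᶜ.indicator fun _ => (1 : ℝ)) (μ.map ξ) :=
      (integrable_const _).indicator hAm.compl
    refine ⟨_, hg, eventually_discrepancy_le_of_bracket hFc hFm hT hξ hgm hgi
      (h := fun x => ε / 5 + Aᶜ.indicator (fun _ => 1) x)
      (measurable_const.add (measurable_const.indicator hAm.compl))
      ((integrable_const _).add hind) ?_ _ fun f hf => ?_⟩
    · rw [integral_add (integrable_const _) hind, integral_indicator_const _ hAm.compl]
      simp only [integral_const, probReal_univ, smul_eq_mul]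
      linarith
    · filter_upwards [hf] with x hx
      by_cases hxA : x ∈ A
      · simpa [hxA] using hx hxA
      · rw [hg0 x hxA, Set.indicator_of_mem (by exact hxA), sub_zero,
          abs_of_nonneg (hFb f.1 f.2 x).1]
        have := (hFb f.1 f.2 x).2
        linarith

end UniformConvergence

theorem discrepancy_tendsto_zero_of_finite_gap_dimension
    {X Ω : Type*} [MetricSpace X] [CompleteSpace X]
    [TopologicalSpace.SeparableSpace X] [MeasurableSpace X] [BorelSpace X]
    (F : Set (X → ℝ)) (hFc : F.Countable)
    (hFm : ∀ f ∈ F, Measurable f)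
    (hFb : ∀ f ∈ F, ∀ x, f x ∈ Set.Icc (0 : ℝ) 1)
    (hdim : ∀ γ : ℝ, 0 < γ → ∃ k : ℕ, ∀ D : Finset X, D.card = k → ¬ GammaShatters F γ D)
    [MeasurableSpace Ω] (μ : Measure Ω) [IsProbabilityMeasure μ]
    (T : Ω → Ω) (ξ : Ω → X) (hT : Ergodic T μ) (hξ : Measurable ξ) :
    ∀ᵐ ω ∂μ, Filter.Tendsto (fun m : ℕ => discrepancy μ T ξ F m ω) Filter.atTop (nhds 0) := by
  have hbound : ∀ k : ℕ, ∀ᵐ ω ∂μ, ∀ᶠ m : ℕ in atTop,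
      discrepancy μ T ξ F m ω ≤ 1 / ((k : ℝ) + 1) := by
    intro k
    filter_upwards [eventually_uniform_average_le hFc hFm hFb hdim hT hξ
      (by positivity : 0 < 1 / ((k : ℝ) + 1))] with ω hω
    filter_upwards [hω] with m hm
    exact Real.iSup_le (fun f => hm f trivial) (by positivity)
  filter_upwards [ae_all_iff.2 hbound] with ω hω
  rw [Metric.tendsto_nhds]
  intro ε hε
  obtain ⟨k, hk⟩ := exists_nat_one_div_lt hε
  filter_upwards [hω k] with m hm
  have h0 : 0 ≤ discrepancy μ T ξ F m ω := Real.iSup_nonneg fun f => abs_nonneg _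
  rw [Real.dist_eq, sub_zero, abs_of_nonneg h0]
  exact hm.trans_lt hk
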